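/- arXiv:2104.04341 — 2 statements merged into one kernel-verified Lean document; each statement's English description precedes it below -/
import Mathlib

section
/- Let 𝒜 = (a_i)_{i≥1} be a sequence of positive integers. For every integer k ≥ 1, at least one of the two natural densities d({n ∈ ℕ : p_𝒜(n,k) ≡ 1 (mod 2)}) and d({n ∈ ℕ : p_𝒜(n,k+1) ≡ 1 (mod 2)}) (which exist by periodicity of p_𝒜(·,k) mod 2) is at most 2/3. In particular, the inequality lim_{N→∞} #{n ≤ N : p_𝒜(n,k) ≡ 1 (mod 2)}/N ≤ 2/3 holds for infinitely many positive integers k. -/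
open Filter

/-- `pA a k n` is the number of multi-color partitions of `n` into parts
`a 1, …, a k`. -/
noncomputable def pA (a : ℕ → ℕ) (k : ℕ) (n : ℤ) : ℕ :=
  Nat.card {x : Fin k → ℕ // ∑ i : Fin k, (x i : ℤ) * (a (i.val + 1) : ℤ) = n}

/-- The solution set counted by `pA`. -/
def partitionTuples (a : ℕ → ℕ) (k : ℕ) (n : ℤ) : Set (Fin k → ℕ) :=
  {x | ∑ i : Fin k, (x i : ℤ) * (a (i.val + 1) : ℤ) = n}

lemma pA_eq_ncard (a : ℕ → ℕ) (k : ℕ) (n : ℤ) : pA a k n = (partitionTuples a k n).ncard :=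
  rfl

lemma finite_partitionTuples {a : ℕ → ℕ} (ha : ∀ i, 0 < a i) (k : ℕ) (n : ℤ) :
    (partitionTuples a k n).Finite := by
  refine (Set.finite_Iic (fun _ : Fin k => n.toNat)).subset fun x hx i => ?_
  have hx' : ∑ i : Fin k, (x i : ℤ) * (a (i.val + 1) : ℤ) = n := hx
  have h1 : (x i : ℤ) * (a (i.val + 1) : ℤ) ≤ n := by
    rw [← hx']
    exact Finset.single_le_sum (f := fun i : Fin k => (x i : ℤ) * (a (i.val + 1) : ℤ))
      (fun j _ => by positivity) (Finset.mem_univ i)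
  have h2 : (1 : ℤ) ≤ a (i.val + 1) := by exact_mod_cast ha _
  have h3 : (x i : ℤ) ≤ n := by nlinarith [Int.natCast_nonneg (x i)]
  change x i ≤ n.toNat
  omega

lemma partitionTuples_succ (a : ℕ → ℕ) (k : ℕ) (n : ℤ) :
    partitionTuples a (k + 1) n =
      (fun x => x + Pi.single (Fin.last k) 1) '' partitionTuples a (k + 1) (n - a (k + 1)) ∪
      (fun x => Fin.snoc (α := fun _ => ℕ) x 0) '' partitionTuples a k n := by
  ext x
  simp only [Set.mem_union, Set.mem_image, partitionTuples, Set.mem_ofPred_eq]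
  constructor
  · intro hx
    by_cases h0 : x (Fin.last k) = 0
    · right
      refine ⟨Fin.init x, ?_, ?_⟩
      · rw [Fin.sum_univ_castSucc, h0] at hx
        simpa [Fin.init] using hx
      · rw [← h0, Fin.snoc_init_self]
    · left
      refine ⟨x - Pi.single (Fin.last k) 1, ?_, ?_⟩
      · rw [Fin.sum_univ_castSucc] at hx ⊢
        have h1 : ((x (Fin.last k) - 1 : ℕ) : ℤ) = x (Fin.last k) - 1 := by omega
        simp [h1, (Fin.castSucc_lt_last _).ne] at hx ⊢
        linarith
      · ext i
        rcases eq_or_ne i (Fin.last k) with rfl | hi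
        · simp; omega
        · simp [hi]
  · rintro (⟨y, hy, rfl⟩ | ⟨y, hy, rfl⟩)
    · rw [Fin.sum_univ_castSucc] at hy ⊢
      simp [(Fin.castSucc_lt_last _).ne] at hy ⊢
      linarith
    · rw [Fin.sum_univ_castSucc]
      simpa using hy

lemma pA_succ {a : ℕ → ℕ} (ha : ∀ i, 0 < a i) (k : ℕ) (n : ℤ) :
    pA a (k + 1) n = pA a (k + 1) (n - a (k + 1)) + pA a k n := by
  simp only [pA_eq_ncard]
  conv_lhs => rw [partitionTuples_succ]
  rw [Set.ncard_union_eq _ ((finite_partitionTuples ha _ _).image _)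
    ((finite_partitionTuples ha _ _).image _), Set.ncard_image_of_injective,
    Set.ncard_image_of_injective]
  · intro x y h
    exact (Fin.snoc_injective2 h).1
  · exact add_left_injective _
  · rw [Set.disjoint_left]
    rintro _ ⟨y, -, rfl⟩ ⟨z, -, hz⟩
    have := congrFun hz (Fin.last k)
    simp at this

lemma pA_zero_of_pos (a : ℕ → ℕ) {n : ℤ} (hn : 0 < n) : pA a 0 n = 0 := by
  have : partitionTuples a 0 n = ∅ := by
    ext x
    simp [partitionTuples, hn.ne]
  rw [pA_eq_ncard, this, Set.ncard_empty]

/-- If a function into `ZMod 2` has eventually periodic differences with step `b`, then it is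
eventually periodic. -/
lemma eventually_periodic_of_step {f g : ℕ → ZMod 2} {b T M : ℕ}
    (hfg : ∀ n, f (n + b) = f n + g (n + b)) (hg : ∀ n, M ≤ n → g (n + T) = g n)
    {n : ℕ} (hn : M ≤ n) : f (n + 2 * (b * T)) = f n := by
  have hgm : ∀ m n, M ≤ n → g (n + m * T) = g n := by
    intro m
    induction m with
    | zero => simp
    | succ m ih =>
      intro n hn
      rw [show n + (m + 1) * T = n + m * T + T by ring, hg _ (by omega), ih n hn]
  have hsum : ∀ m n, f (n + b * m) = f n + ∑ j ∈ Finset.range m, g (n + b * (j + 1)) := by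
    intro m n
    induction m with
    | zero => simp
    | succ m ih =>
      rw [Finset.sum_range_succ, show n + b * (m + 1) = n + b * m + b by ring, hfg, ih, add_assoc]
  rw [show n + 2 * (b * T) = n + b * T + b * T by ring, hsum T (n + b * T), hsum T n, add_assoc]
  have : ∑ j ∈ Finset.range T, g (n + b * T + b * (j + 1)) =
      ∑ j ∈ Finset.range T, g (n + b * (j + 1)) := by
    refine Finset.sum_congr rfl fun j _ => ?_
    rw [show n + b * T + b * (j + 1) = n + b * (j + 1) + b * T by ring]
    exact hgm b _ (by omega)
  rw [this, CharTwo.add_self_eq_zero, add_zero]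

lemma exists_period_pA {a : ℕ → ℕ} (ha : ∀ i, 0 < a i) (k : ℕ) :
    ∃ T, 0 < T ∧ ∀ n : ℕ, 1 ≤ n → (pA a k ((n + T : ℕ) : ℤ) : ZMod 2) = pA a k (n : ℤ) := by
  induction k with
  | zero =>
    refine ⟨1, one_pos, fun n hn => ?_⟩
    rw [pA_zero_of_pos a (by omega), pA_zero_of_pos a (by omega)]
  | succ k ih =>
    obtain ⟨T, hT, h⟩ := ih
    refine ⟨2 * (a (k + 1) * T), by have := ha (k + 1); positivity, fun n hn => ?_⟩
    refine eventually_periodic_of_step (f := fun n : ℕ => (pA a (k + 1) (n : ℤ) : ZMod 2))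
      (g := fun n : ℕ => (pA a k (n : ℤ) : ZMod 2)) (fun n => ?_) h hn
    rw [pA_succ ha k ((n + a (k + 1) : ℕ) : ℤ)]
    push_cast
    rw [add_sub_cancel_right]

lemma tendsto_const_add_div (c b : ℝ) :
    Tendsto (fun N : ℕ => (c * ((N : ℝ) + 1) + b) / N) atTop (nhds c) := by
  have h : Tendsto (fun N : ℕ => c + (c + b) / (N : ℝ)) atTop (nhds (c + 0)) :=
    tendsto_const_nhds.add (tendsto_const_div_atTop_nhds_zero_nat _)
  rw [add_zero] at h
  refine h.congr' ?_
  filter_upwards [eventually_gt_atTop 0] with N hN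
  have : (N : ℝ) ≠ 0 := by positivity
  field_simp
  ring

/-- The running averages of an eventually periodic real sequence converge. -/
lemma exists_tendsto_average_of_eventually_periodic {u : ℕ → ℝ} {T M : ℕ} (hT : 0 < T)
    (hu : ∀ n, M ≤ n → u (n + T) = u n) :
    ∃ d : ℝ, Tendsto (fun N : ℕ => (∑ i ∈ Finset.range (N + 1), u i) / N) atTop (nhds d) := by
  set C : ℕ → ℝ := fun N => ∑ i ∈ Finset.range N, u i with hC
  have hT' : (T : ℝ) ≠ 0 := by positivity
  obtain ⟨c, hc⟩ : ∃ c, ∀ n, M ≤ n → C (n + T) = C n + c := by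
    refine ⟨C (M + T) - C M, fun n hn => ?_⟩
    induction n, hn using Nat.le_induction with
    | base => ring
    | succ n hn ih =>
      have h1 : C (n + 1 + T) = C (n + T) + u (n + T) := by
        rw [show n + 1 + T = n + T + 1 by ring]
        exact Finset.sum_range_succ _ _
      have h2 : C (n + 1) = C n + u n := Finset.sum_range_succ _ _
      rw [h1, h2, ih, hu n hn]
      ring
  obtain ⟨B, hB⟩ : ∃ B, ∀ n, |C n - c / T * n| ≤ B := by
    refine ⟨∑ i ∈ Finset.range (M + T), |C i - c / T * i|, fun n => ?_⟩
    induction n using Nat.strong_induction_on with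
    | _ n ih =>
      by_cases hn : n < M + T
      · exact Finset.single_le_sum (f := fun i : ℕ => |C i - c / T * i|)
          (fun _ _ => abs_nonneg _) (Finset.mem_range.2 hn)
      · obtain ⟨m, rfl⟩ : ∃ m, n = m + T := ⟨n - T, by omega⟩
        have h := ih m (by omega)
        rw [hc m (by omega)]
        convert h using 2
        push_cast
        field_simp
        ring
  refine ⟨c / T, tendsto_of_tendsto_of_tendsto_of_le_of_le (tendsto_const_add_div (c / T) (-B))
    (tendsto_const_add_div (c / T) B) (fun N => ?_) (fun N => ?_)⟩
  all_goals
    have h := abs_le.1 (hB (N + 1))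
    push_cast at h
    refine div_le_div_of_nonneg_right ?_ (Nat.cast_nonneg N)
    simp only [hC] at h
    linarith

lemma exists_odd_density_pA {a : ℕ → ℕ} (ha : ∀ i, 0 < a i) (k : ℕ) :
    ∃ d : ℝ, Tendsto (fun N : ℕ =>
      (((Finset.range (N + 1)).filter (fun n : ℕ => pA a k (n : ℤ) % 2 = 1)).card : ℝ) / N)
      atTop (nhds d) := by
  obtain ⟨T, hT, h⟩ := exists_period_pA ha k
  obtain ⟨d, hd⟩ := exists_tendsto_average_of_eventually_periodic
    (u := fun n : ℕ => if pA a k (n : ℤ) % 2 = 1 then (1 : ℝ) else 0) (M := 1) hT (fun n hn => by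
      have h' : pA a k ((n + T : ℕ) : ℤ) % 2 = pA a k (n : ℤ) % 2 :=
        (ZMod.natCast_eq_natCast_iff' _ _ _).1 (h n hn)
      simp only [h'])
  exact ⟨d, by simpa only [Finset.sum_boole] using hd⟩

lemma odd_count_add_two_mul_le {a : ℕ → ℕ} (ha : ∀ i, 0 < a i) (k N : ℕ) :
    ((Finset.range N).filter (fun n : ℕ => pA a k (n : ℤ) % 2 = 1)).card +
      2 * ((Finset.range N).filter (fun n : ℕ => pA a (k + 1) (n : ℤ) % 2 = 1)).card ≤
      2 * N + 2 * a (k + 1) := by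
  set b := a (k + 1) with hb
  set C : ℕ → ℕ → ℕ := fun k N =>
    ((Finset.range N).filter (fun n : ℕ => pA a k (n : ℤ) % 2 = 1)).card with hC
  have hmono : ∀ k, C k N ≤ C k (N + b) := fun k =>
    Finset.card_le_card (Finset.filter_subset_filter _ (Finset.range_mono (by omega)))
  have hle : ∀ k N, C k N ≤ N := fun k N =>
    (Finset.card_filter_le _ _).trans (Finset.card_range N).le
  have hsucc : ∀ k N, C k (N + 1) = C k N + if pA a k (N : ℤ) % 2 = 1 then 1 else 0 := by
    intro k N
    simp only [hC, Finset.card_filter, Finset.sum_range_succ]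
  have key : ∀ N, C k (N + b) + C (k + 1) (N + b) + C (k + 1) N ≤ 2 * N + 2 * b := by
    intro N
    induction N with
    | zero =>
      have := hle k b
      have := hle (k + 1) b
      have := hle (k + 1) 0
      simp only [zero_add]
      omega
    | succ N ih =>
      have hrec := pA_succ ha k ((N + b : ℕ) : ℤ)
      rw [show ((N + b : ℕ) : ℤ) - a (k + 1) = N by push_cast; ring] at hrec
      rw [show N + 1 + b = N + b + 1 by ring, hsucc, hsucc, hsucc]
      split_ifs <;> omega
  have := key N
  have := hmono k
  have := hmono (k + 1)
  change C k N + 2 * C (k + 1) N ≤ _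
  omega

/-- The density of odd values of `pA a k` exists (by periodicity), and for every
`k ≥ 1` at least one of the odd densities at level `k` and at level `k + 1` is
at most `2/3`; in particular the bound `≤ 2/3` holds for infinitely many `k`. -/
theorem stmt_3 (a : ℕ → ℕ) (ha : ∀ i, 0 < a i) (k : ℕ) (hk : 1 ≤ k) :
    ∃ d₁ d₂ : ℝ,
      Tendsto (fun N : ℕ =>
          (((Finset.range (N + 1)).filter (fun n : ℕ =>
            pA a k (n : ℤ) % 2 = 1)).card : ℝ) / N) atTop (nhds d₁) ∧
      Tendsto (fun N : ℕ =>
          (((Finset.range (N + 1)).filter (fun n : ℕ =>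
            pA a (k + 1) (n : ℤ) % 2 = 1)).card : ℝ) / N) atTop (nhds d₂) ∧
      (d₁ ≤ 2 / 3 ∨ d₂ ≤ 2 / 3) := by
  obtain ⟨d₁, h₁⟩ := exists_odd_density_pA ha k
  obtain ⟨d₂, h₂⟩ := exists_odd_density_pA ha (k + 1)
  refine ⟨d₁, d₂, h₁, h₂, ?_⟩
  have hle : d₁ + 2 * d₂ ≤ 2 := by
    refine le_of_tendsto_of_tendsto' (h₁.add (h₂.const_mul 2))
      (tendsto_const_add_div 2 (2 * a (k + 1))) fun N => ?_
    rw [← mul_div_assoc, ← add_div]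
    refine div_le_div_of_nonneg_right ?_ (Nat.cast_nonneg N)
    exact_mod_cast odd_count_add_two_mul_le ha k (N + 1)
  by_contra! h
  linarith [h.1, h.2]
end

section
/- Let m be a prime number, let i ∈ {1,2,…,m−1} and let k ≥ 2 be an integer. Then the congruence p_ℳ(n,k) ≡ i (mod m) has exactly m(m−1)^{k−2} distinct solutions n modulo m^k; i.e. #{n ∈ {0,1,…,m^k−1} : p_ℳ(n,k) ≡ i (mod m)} = m(m−1)^{k−2}. -/
/-- `pM m k n` is the number of restricted `m`-ary partitions of `n` with parts
`1, m, m^2, …, m^(k-1)`. -/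
noncomputable def pM (m k n : ℕ) : ℕ :=
  Nat.card {x : Fin k → ℕ // ∑ i : Fin k, x i * m ^ (i : ℕ) = n}

theorem finite_restricted_partitions {m : ℕ} (hm : 0 < m) (k n : ℕ) :
    Finite {x : Fin k → ℕ // ∑ i : Fin k, x i * m ^ (i : ℕ) = n} := by
  refine ((Set.finite_Iic (fun _ : Fin k => n)).subset ?_).to_subtype
  intro x hx i
  calc x i ≤ x i * m ^ (i : ℕ) := Nat.le_mul_of_pos_right _ (pow_pos hm _)
    _ ≤ ∑ i : Fin k, x i * m ^ (i : ℕ) :=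
      Finset.single_le_sum (f := fun i : Fin k => x i * m ^ (i : ℕ))
        (fun _ _ => Nat.zero_le _) (Finset.mem_univ i)
    _ = n := hx

theorem sum_mul_pow_succ (m k : ℕ) (x : Fin (k + 1) → ℕ) :
    ∑ i : Fin (k + 1), x i * m ^ (i : ℕ) =
      x 0 + m * ∑ i : Fin k, x i.succ * m ^ (i : ℕ) := by
  rw [Fin.sum_univ_succ, Finset.mul_sum]
  simp only [Fin.val_zero, pow_zero, mul_one, Fin.val_succ, pow_succ]
  congr 1
  exact Finset.sum_congr rfl fun i _ => by ring

/-- Removing the parts equal to `1` splits the partitions of `n` according to the partition of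
some `j ≤ n / m` formed by the remaining parts divided by `m`. -/
def restrictedPartitionsEquiv {m : ℕ} (hm : 0 < m) (k n : ℕ) :
    {x : Fin (k + 1) → ℕ // ∑ i : Fin (k + 1), x i * m ^ (i : ℕ) = n} ≃
      Σ j : Fin (n / m + 1), {y : Fin k → ℕ // ∑ i : Fin k, y i * m ^ (i : ℕ) = j} where
  toFun x := ⟨⟨∑ i : Fin k, x.1 i.succ * m ^ (i : ℕ), by
    have h := x.2
    rw [sum_mul_pow_succ] at h
    rw [Nat.lt_succ_iff, Nat.le_div_iff_mul_le hm, mul_comm]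
    omega⟩, ⟨fun i => x.1 i.succ, rfl⟩⟩
  invFun y := ⟨Fin.cons (n - m * y.1) y.2.1, by
    have h : y.1 * m ≤ n := (Nat.le_div_iff_mul_le hm).1 (Nat.lt_succ_iff.1 y.1.2)
    rw [sum_mul_pow_succ]
    simp only [Fin.cons_zero, Fin.cons_succ, y.2.2]
    rw [mul_comm] at h
    omega⟩
  left_inv x := by
    have h := x.2
    rw [sum_mul_pow_succ] at h
    apply Subtype.ext
    funext i
    refine Fin.cases ?_ (fun i => ?_) i
    · simp only [Fin.cons_zero]
      omega
    · simp only [Fin.cons_succ]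
  right_inv := by
    rintro ⟨⟨j, hj⟩, ⟨y, hy⟩⟩
    simp only at hy
    subst hy
    rfl

theorem pM_zero_right {m : ℕ} (hm : 0 < m) (k : ℕ) : pM m k 0 = 1 := by
  rw [pM, Nat.card_eq_one_iff_unique]
  refine ⟨⟨fun x y => Subtype.ext (funext fun i => ?_)⟩, ⟨⟨0, by simp⟩⟩⟩
  have hx := x.2
  have hy := y.2
  simp only [Finset.sum_eq_zero_iff, Finset.mem_univ, true_implies, mul_eq_zero,
    (pow_pos hm _).ne', or_false] at hx hy
  rw [hx i, hy i]

theorem pM_succ {m : ℕ} (hm : 0 < m) (k n : ℕ) :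
    pM m (k + 1) n = ∑ j ∈ Finset.range (n / m + 1), pM m k j := by
  have := fun j : Fin (n / m + 1) => finite_restricted_partitions hm k j
  rw [pM, Nat.card_congr (restrictedPartitionsEquiv hm k n), Nat.card_sigma,
    ← Fin.sum_univ_eq_sum_range]
  rfl

theorem pM_zero_left_of_pos (m : ℕ) {n : ℕ} (hn : 0 < n) : pM m 0 n = 0 := by
  rw [pM, Nat.card_eq_zero]
  exact Or.inl ⟨fun x => hn.ne (by simpa using x.2)⟩

theorem pM_one {m : ℕ} (hm : 0 < m) (n : ℕ) : pM m 1 n = 1 := by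
  rw [pM_succ hm, Finset.sum_eq_single_of_mem 0 (by simp)
    fun j _ hj => pM_zero_left_of_pos m (Nat.pos_of_ne_zero hj), pM_zero_right hm]

theorem sum_range_mul_eq {M : Type*} [AddCommMonoid M] (m N : ℕ) (f : ℕ → M) :
    ∑ n ∈ Finset.range (m * N), f n =
      ∑ q ∈ Finset.range N, ∑ r ∈ Finset.range m, f (m * q + r) := by
  induction N with
  | zero => simp
  | succ N ih => rw [mul_add, mul_one, Finset.sum_range_add, ih, Finset.sum_range_succ]

theorem pM_mul_add {m r : ℕ} (hr : r < m) (k q : ℕ) :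
    pM m (k + 1) (m * q + r) = pM m (k + 1) (m * q) := by
  have hm : 0 < m := by omega
  rw [pM_succ hm, pM_succ hm, Nat.mul_add_div hm, Nat.div_eq_of_lt hr, Nat.mul_div_cancel_left _ hm,
    add_zero]

/-- Modulo `m`, complete blocks of `m` consecutive arguments contribute `0` to the sum in
`pM_succ`, so only the last, partial block survives. -/
theorem pM_add_two_cast {m r : ℕ} (hr : r < m) (k q : ℕ) :
    (pM m (k + 2) (m * (m * q + r)) : ZMod m) = (r + 1) * pM m (k + 1) (m * q) := by
  have hm : 0 < m := by omega
  have block : ∀ s ≤ m, ∀ t, ∑ j ∈ Finset.range s, (pM m (k + 1) (m * t + j) : ZMod m) =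
      s * pM m (k + 1) (m * t) := by
    intro s hs t
    rw [Finset.sum_congr rfl fun j hj => by
      rw [pM_mul_add ((Finset.mem_range.1 hj).trans_le hs)]]
    simp
  rw [pM_succ hm, Nat.mul_div_cancel_left _ hm, Nat.cast_sum, add_assoc, Finset.sum_range_add,
    sum_range_mul_eq, Finset.sum_eq_zero fun t _ => by simp [block m le_rfl t],
    block _ hr]
  simp

section Counting

variable {m : ℕ} [Fact m.Prime]

theorem card_filter_eq_ite (a c : ZMod m) (hc : c ≠ 0) :
    ((Finset.range m).filter fun r : ℕ => ((r : ZMod m) + 1) * a = c).card =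
      if a ≠ 0 then 1 else 0 := by
  have hm : 0 < m := (Fact.out : m.Prime).pos
  have : NeZero m := ⟨hm.ne'⟩
  split_ifs with ha
  · rw [Finset.card_eq_one]
    refine ⟨(c / a - 1).val, ?_⟩
    ext r
    simp only [Finset.mem_filter, Finset.mem_range, Finset.mem_singleton]
    constructor
    · rintro ⟨hr, h⟩
      rw [← h, mul_div_cancel_right₀ _ ha, add_sub_cancel_right, ZMod.val_cast_of_lt hr]
    · rintro rfl
      exact ⟨ZMod.val_lt _, by simp [div_mul_cancel₀ _ ha]⟩
  · rw [not_not] at ha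
    simp [ha, hc.symm]

theorem card_pM_cast_eq_of_ne_zero (k : ℕ) (c : ZMod m) (hc : c ≠ 0) :
    ((Finset.range (m ^ (k + 1))).filter
      fun q : ℕ => (pM m (k + 2) (m * q) : ZMod m) = c).card =
    ((Finset.range (m ^ k)).filter
      fun q : ℕ => (pM m (k + 1) (m * q) : ZMod m) ≠ 0).card := by
  rw [Finset.card_filter, Finset.card_filter, pow_succ', sum_range_mul_eq]
  refine Finset.sum_congr rfl fun q _ => ?_
  rw [← card_filter_eq_ite _ c hc, Finset.card_filter]
  refine Finset.sum_congr rfl fun r hr => ?_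
  rw [pM_add_two_cast (Finset.mem_range.1 hr)]

theorem card_pM_cast_ne_zero (k : ℕ) :
    ((Finset.range (m ^ k)).filter
      fun q : ℕ => (pM m (k + 1) (m * q) : ZMod m) ≠ 0).card = (m - 1) ^ k := by
  have hm : m.Prime := Fact.out
  induction k with
  | zero => simp [pM_one hm.pos]
  | succ k ih =>
    rw [Finset.card_eq_sum_card_fiberwise
      (f := fun q : ℕ => (pM m (k + 2) (m * q) : ZMod m)) (t := Finset.univ.erase 0)
      (fun q hq => by simpa using (Finset.mem_filter.1 (Finset.mem_coe.1 hq)).2)]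
    have fiber : ∀ c ∈ Finset.univ.erase (0 : ZMod m),
        (((Finset.range (m ^ (k + 1))).filter
          fun q : ℕ => (pM m (k + 1 + 1) (m * q) : ZMod m) ≠ 0).filter
          fun q : ℕ => (pM m (k + 2) (m * q) : ZMod m) = c).card = (m - 1) ^ k := by
      intro c hc
      have hc0 : c ≠ 0 := Finset.ne_of_mem_erase hc
      rw [← ih, ← card_pM_cast_eq_of_ne_zero k c hc0, Finset.filter_filter]
      congr 1
      refine Finset.filter_congr fun q _ => ⟨fun h => h.2, fun h => ⟨h ▸ hc0, h⟩⟩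
    rw [Finset.sum_congr rfl fiber, Finset.sum_const, Finset.card_erase_of_mem (Finset.mem_univ _),
      Finset.card_univ, ZMod.card, smul_eq_mul, pow_succ']

end Counting

theorem stmt_7 (m : ℕ) (hm : m.Prime) (i : ℕ) (hi1 : 1 ≤ i) (hi2 : i ≤ m - 1)
    (k : ℕ) (hk : 2 ≤ k) :
    ((Finset.range (m ^ k)).filter (fun n : ℕ => pM m k n % m = i)).card =
      m * (m - 1) ^ (k - 2) := by
  obtain ⟨k, rfl⟩ := Nat.exists_eq_add_of_le' hk
  have : Fact m.Prime := ⟨hm⟩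
  have him : i < m := by have := hm.pos; omega
  have hi0 : (i : ZMod m) ≠ 0 := fun h =>
    absurd (Nat.le_of_dvd hi1 ((ZMod.natCast_eq_zero_iff i m).1 h)) (by omega)
  have hcast : ∀ n : ℕ, n % m = i ↔ (n : ZMod m) = i := fun n => by
    rw [ZMod.natCast_eq_natCast_iff', Nat.mod_eq_of_lt him]
  simp only [hcast]
  rw [Nat.add_sub_cancel, ← card_pM_cast_ne_zero, ← card_pM_cast_eq_of_ne_zero k i hi0,
    Finset.card_filter, Finset.card_filter, pow_succ', sum_range_mul_eq, Finset.mul_sum]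
  refine Finset.sum_congr rfl fun q _ => ?_
  rw [Finset.sum_congr rfl fun r hr => by
    rw [pM_mul_add (Finset.mem_range.1 hr)], Finset.sum_const, Finset.card_range,
    smul_eq_mul]
end
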